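/- For every integer n ≥ 1, the Staller-start game isolation number of the path P_n satisfies ι_g'(P_n) = ⌊(2n+2)/5⌋. -/

import Mathlib

open SimpleGraph

variable {V : Type*}

/-- The closed neighborhood `N_G[X]` of a set `X` of vertices: all vertices that are in `X`
or adjacent to a vertex of `X`. -/
def closedNbhdSet (G : SimpleGraph V) (X : Set V) : Set V :=
  {u | u ∈ X ∨ ∃ x ∈ X, G.Adj x u}

/-- A vertex `v` is playable with respect to the set `X` of already selected vertices if the
closed neighborhood of `v` contains a vertex `u ∉ N_G[X]` having a neighbor `w ∉ N_G[X]`,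
i.e. `v` dominates a vertex of a nontrivial component of `G - N_G[X]`. -/
def IsPlayable (G : SimpleGraph V) (X : Set V) (v : V) : Prop :=
  ∃ u, (u = v ∨ G.Adj v u) ∧ u ∉ closedNbhdSet G X ∧
    ∃ w, G.Adj u w ∧ w ∉ closedNbhdSet G X

open Classical in
/-- The optimal-play value (number of further selected vertices) of the isolation game
position with given fuel, player to move (`true` = Dominator, the minimizer;
`false` = Staller, the maximizer) and set `X` of already selected vertices. -/
noncomputable def isoGameVal (G : SimpleGraph V) : ℕ → Bool → Set V → ℕ
  | 0, _, _ => 0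
  | (k + 1), isDom, X =>
    if ∃ v, IsPlayable G X v then
      (if isDom then sInf else sSup)
        {n : ℕ | ∃ v, IsPlayable G X v ∧ n = isoGameVal G k (!isDom) (insert v X) + 1}
    else 0

/-- The game isolation number `ι_g(G)`: the number of vertices selected in the isolation
game on `G` when Dominator moves first and both players play optimally.  (A game on a
graph with `n` vertices lasts at most `n` moves, so fuel `Fintype.card V` suffices.) -/
noncomputable def iotaGame (G : SimpleGraph V) [Fintype V] : ℕ :=
  isoGameVal G (Fintype.card V) true ∅

/-- The Staller-start game isolation number `ι_g'(G)`: the number of vertices selected in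
the isolation game on `G` when Staller moves first and both players play optimally. -/
noncomputable def iotaGame' (G : SimpleGraph V) [Fintype V] : ℕ :=
  isoGameVal G (Fintype.card V) false ∅

/-- The weight of a run of `m` consecutive undominated vertices, in eighths of a move. -/
def runWeight (m : ℕ) : ℕ :=
  16 * ((m - 1) / 5) + (if (m - 1) % 5 = 0 then 0 else if (m - 1) % 5 = 1 then 8
    else if (m - 1) % 5 = 2 then 12 else if (m - 1) % 5 = 3 then 14 else 15)

theorem runWeight_cases (m : ℕ) : ∃ q, (m = 0 ∧ runWeight m = 0) ∨
    (m = 5 * q + 1 ∧ runWeight m = 16 * q) ∨ (m = 5 * q + 2 ∧ runWeight m = 16 * q + 8) ∨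
    (m = 5 * q + 3 ∧ runWeight m = 16 * q + 12) ∨ (m = 5 * q + 4 ∧ runWeight m = 16 * q + 14) ∨
    (m = 5 * q + 5 ∧ runWeight m = 16 * q + 15) := by
  refine ⟨(m - 1) / 5, ?_⟩
  unfold runWeight
  split_ifs <;> omega

theorem runWeight_add_three (a b : ℕ) :
    runWeight a + runWeight b + 1 ≤ runWeight (a + b + 3) ∧
      runWeight (a + b + 3) ≤ runWeight a + runWeight b + 15 := by
  obtain ⟨q, hq⟩ := runWeight_cases a
  obtain ⟨r, hr⟩ := runWeight_cases b
  obtain ⟨t, ht⟩ := runWeight_cases (a + b + 3)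
  rcases hq with hq | hq | hq | hq | hq | hq <;> rcases hr with hr | hr | hr | hr | hr | hr <;>
    omega

theorem runWeight_move {m p : ℕ} (hm : 2 ≤ m) (hp : p ≤ m + 1) :
    runWeight (p - 2) + runWeight (m - p - 1) + 1 ≤ runWeight m ∧
      runWeight m ≤ runWeight (p - 2) + runWeight (m - p - 1) + 15 := by
  have h0 : runWeight 0 = 0 := rfl
  have h1 : runWeight 1 = 0 := rfl
  obtain ⟨k, rfl⟩ : ∃ k, m = k + 2 := ⟨m - 2, by omega⟩
  have end_bounds : ∀ j, k ≤ j + 1 → j ≤ k + 1 →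
      runWeight j + 1 ≤ runWeight (k + 2) ∧ runWeight (k + 2) ≤ runWeight j + 15 := by
    intro j hj hj'
    obtain ⟨q, hq⟩ := runWeight_cases j
    obtain ⟨r, hr⟩ := runWeight_cases (k + 2)
    rcases hq with hq | hq | hq | hq | hq | hq <;> omega
  by_cases hleft : p ≤ 2
  · have := end_bounds (k + 2 - p - 1) (by omega) (by omega)
    rw [show p - 2 = 0 by omega]
    omega
  by_cases hright : k + 1 ≤ p
  · have := end_bounds (p - 2) (by omega) (by omega)
    rw [show k + 2 - p - 1 = 0 by omega]
    omega
  · have := runWeight_add_three (p - 2) (k + 2 - p - 1)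
    rwa [show p - 2 + (k + 2 - p - 1) + 3 = k + 2 by omega] at this

/-- Removing one vertex, respectively four vertices, from a run changes its weight by at most,
respectively at least, an amount governed by the power of two dividing the weight. -/
theorem runWeight_balanced {m : ℕ} (hm : 2 ≤ m) :
    (runWeight m % 2 ≠ 0 →
      runWeight m ≤ runWeight (m - 1) + 1 ∧ runWeight (m - 4) + 15 ≤ runWeight m) ∧
    (runWeight m % 4 ≠ 0 →
      runWeight m ≤ runWeight (m - 1) + 2 ∧ runWeight (m - 4) + 14 ≤ runWeight m) ∧
    (runWeight m % 8 ≠ 0 →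
      runWeight m ≤ runWeight (m - 1) + 4 ∧ runWeight (m - 4) + 12 ≤ runWeight m) ∧
    runWeight m ≤ runWeight (m - 1) + 8 ∧ runWeight (m - 4) + 8 ≤ runWeight m := by
  obtain ⟨q, hq⟩ := runWeight_cases m
  obtain ⟨r, hr⟩ := runWeight_cases (m - 1)
  obtain ⟨t, ht⟩ := runWeight_cases (m - 4)
  rcases hq with hq | hq | hq | hq | hq | hq <;> rcases hr with hr | hr | hr | hr | hr | hr <;>
    omega

theorem two_le_of_runWeight_ne_zero {m : ℕ} (h : runWeight m ≠ 0) : 2 ≤ m := by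
  by_contra! hm
  interval_cases m <;> simp [runWeight] at h

/-- The length of the run of consecutive elements of `A` ending at `k`. -/
def runLength (A : Finset ℕ) : ℕ → ℕ
  | 0 => if 0 ∈ A then 1 else 0
  | k + 1 => if k + 1 ∈ A then runLength A k + 1 else 0

/-- The total weight of the maximal runs of `A`. -/
def runPotential (A : Finset ℕ) : ℕ :=
  ∑ k ∈ A.filter (fun k => k + 1 ∉ A), runWeight (runLength A k)

/-- The interval `[s, s + m)` is a maximal run of `A`. -/
structure IsRun (A : Finset ℕ) (s m : ℕ) : Prop where
  mem : ∀ i, s ≤ i → i < s + m → i ∈ A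
  left : ∀ i, i + 1 = s → i ∉ A
  right : s + m ∉ A

/-- No element of `A` equals or is adjacent to an element of `B`. -/
def Separated (A B : Finset ℕ) : Prop := ∀ a ∈ A, ∀ b ∈ B, a + 1 < b ∨ b + 1 < a

theorem runLength_eq_of_isRun {A : Finset ℕ} {s m : ℕ} (hmem : ∀ i, s ≤ i → i ≤ s + m → i ∈ A)
    (hleft : ∀ i, i + 1 = s → i ∉ A) : runLength A (s + m) = m + 1 := by
  induction m with
  | zero =>
    have hs := hmem s le_rfl le_rfl
    cases s with
    | zero => simp [runLength, hs]
    | succ s =>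
      have h0 : runLength A s = 0 := by
        cases s <;> simp [runLength, hleft]
      simp [runLength, hs, h0]
  | succ m ih =>
    have h1 := hmem (s + m + 1) (by omega) (by omega)
    have h2 := ih fun i hi hi' => hmem i hi (by omega)
    rw [← add_assoc, runLength, if_pos h1, h2]

theorem isRun_runLength {A : Finset ℕ} {k : ℕ} (hk : k ∈ A) (hk' : k + 1 ∉ A) :
    ∃ s, IsRun A s (runLength A k) ∧ s + runLength A k = k + 1 := by
  suffices h : ∃ s, s + runLength A k = k + 1 ∧ (∀ i, s ≤ i → i ≤ k → i ∈ A) ∧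
      ∀ i, i + 1 = s → i ∉ A by
    obtain ⟨s, h1, h2, h3⟩ := h
    exact ⟨s, ⟨fun i hi hi' => h2 i hi (by omega), h3, h1 ▸ hk'⟩, h1⟩
  clear hk'
  induction k with
  | zero =>
    refine ⟨0, by simp [runLength, hk], ?_, by simp⟩
    intro i _ hi
    obtain rfl : i = 0 := by omega
    exact hk
  | succ k ih =>
    by_cases h : k ∈ A
    · obtain ⟨s, h1, h2, h3⟩ := ih h
      refine ⟨s, by simp [runLength, hk]; omega, ?_, h3⟩
      intro i hi hi'
      rcases Nat.lt_or_ge k i with h' | h'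
      · obtain rfl : i = k + 1 := by omega
        exact hk
      · exact h2 i hi h'
    · have h0 : runLength A k = 0 := by
        cases k <;> simp [runLength, h]
      refine ⟨k + 1, by simp [runLength, hk, h0], ?_, ?_⟩
      · intro i hi hi'
        obtain rfl : i = k + 1 := by omega
        exact hk
      · intro i hi
        obtain rfl : i = k := by omega
        exact h

theorem exists_isRun {A : Finset ℕ} {u : ℕ} (hu : u ∈ A) :
    ∃ s m, IsRun A s m ∧ s ≤ u ∧ u < s + m := by
  have hex : ∃ j, u + j + 1 ∉ A := by
    by_contra! h
    have : u + A.sup id + 1 ≤ A.sup id := Finset.le_sup (f := id) (h _)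
    omega
  classical
  have hfind := Nat.find_spec hex
  have hmin : ∀ j, j < Nat.find hex → u + j + 1 ∈ A := fun j hj => by
    simpa using Nat.find_min hex hj
  generalize Nat.find hex = j at hfind hmin
  have hall : ∀ i, u ≤ i → i ≤ u + j → i ∈ A := fun i hi hi' => by
    rcases hi.eq_or_lt with rfl | h
    · exact hu
    · have := hmin (i - u - 1) (by omega)
      rwa [show u + (i - u - 1) + 1 = i by omega] at this
  obtain ⟨s, hs, hs'⟩ := isRun_runLength (hall (u + j) (by omega) le_rfl) hfind
  refine ⟨s, _, hs, ?_, by omega⟩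
  by_contra! h
  exact hs.left (s - 1) (by omega) (hall (s - 1) (by omega) (by omega))

theorem runLength_union {A B : Finset ℕ} (h : Separated A B) {k : ℕ} (hk : k ∈ A) :
    runLength (A ∪ B) k = runLength A k := by
  induction k with
  | zero => simp [runLength, hk]
  | succ k ih =>
    by_cases hkA : k ∈ A
    · simp [runLength, hk, ih hkA]
    · have hkB : k ∉ B := fun hB => by have := h _ hk _ hB; omega
      have h0 : ∀ C : Finset ℕ, k ∉ C → runLength C k = 0 := fun C hC => by
        cases k <;> simp [runLength, hC]
      simp [runLength, hk, h0 A hkA, h0 (A ∪ B) (by simp [hkA, hkB])]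

theorem Separated.symm {A B : Finset ℕ} (h : Separated A B) : Separated B A :=
  fun b hb a ha => (h a ha b hb).symm

theorem runPotential_union {A B : Finset ℕ} (h : Separated A B) :
    runPotential (A ∪ B) = runPotential A + runPotential B := by
  have hdisj : Disjoint (A.filter fun k => k + 1 ∉ A) (B.filter fun k => k + 1 ∉ B) := by
    rw [Finset.disjoint_left]
    intro a ha hb
    have := h a (Finset.mem_filter.1 ha).1 a (Finset.mem_filter.1 hb).1
    omega
  have hfilter : (A ∪ B).filter (fun k => k + 1 ∉ A ∪ B) =
      (A.filter fun k => k + 1 ∉ A) ∪ (B.filter fun k => k + 1 ∉ B) := by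
    ext k
    simp only [Finset.mem_filter, Finset.mem_union]
    have h1 : k ∈ A → k + 1 ∉ B := fun ha hb => by have := h _ ha _ hb; omega
    have h2 : k ∈ B → k + 1 ∉ A := fun hb ha => by have := h _ ha _ hb; omega
    tauto
  unfold runPotential
  rw [hfilter, Finset.sum_union hdisj]
  congr 1
  · refine Finset.sum_congr rfl fun k hk => ?_
    rw [runLength_union h (Finset.mem_filter.1 hk).1]
  · refine Finset.sum_congr rfl fun k hk => ?_
    rw [Finset.union_comm, runLength_union h.symm (Finset.mem_filter.1 hk).1]

theorem runPotential_Ico (s t : ℕ) : runPotential (Finset.Ico s t) = runWeight (t - s) := by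
  rcases Nat.lt_or_ge s t with h | h
  · obtain ⟨m, rfl⟩ : ∃ m, t = s + m + 1 := ⟨t - s - 1, by omega⟩
    have hfilter : (Finset.Ico s (s + m + 1)).filter (fun k => k + 1 ∉ Finset.Ico s (s + m + 1)) =
        {s + m} := by
      ext k
      simp only [Finset.mem_filter, Finset.mem_Ico, Finset.mem_singleton]
      omega
    rw [runPotential, hfilter, Finset.sum_singleton,
      runLength_eq_of_isRun (fun i _ _ => by simp; omega) (fun i _ => by simp; omega)]
    congr 1
    omega
  · rw [Finset.Ico_eq_empty (by omega), Nat.sub_eq_zero_of_le h]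
    rfl

/-- The elements of `A` that are neither equal nor adjacent to `v`. -/
def removeNear (A : Finset ℕ) (v : ℕ) : Finset ℕ :=
  A.filter fun k => ¬(v ≤ k + 1 ∧ k ≤ v + 1)

theorem runPotential_removeNear_Ico (s t v : ℕ) :
    runPotential (removeNear (Finset.Ico s t) v) =
      runWeight (min t (v - 1) - s) + runWeight (t - max s (v + 2)) := by
  have hsplit : removeNear (Finset.Ico s t) v =
      Finset.Ico s (min t (v - 1)) ∪ Finset.Ico (max s (v + 2)) t := by
    ext k
    simp only [removeNear, Finset.mem_filter, Finset.mem_Ico, Finset.mem_union]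
    omega
  rw [hsplit, runPotential_union, runPotential_Ico, runPotential_Ico]
  intro a ha b hb
  simp only [Finset.mem_Ico] at ha hb
  omega

theorem IsRun.runPotential_removeNear {A : Finset ℕ} {s m v : ℕ} (h : IsRun A s m)
    (hgap : v ∉ A → ∀ i, i + 1 = v → i ∈ A → v + 1 ∉ A) (hm : 2 ≤ m)
    (hv : s ≤ v + 1) (hv' : v ≤ s + m) :
    runPotential (removeNear A v) + runWeight m =
      runPotential A + runWeight (v + 1 - s - 2) + runWeight (m - (v + 1 - s) - 1) := by
  set I := Finset.Ico s (s + m) with hI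
  have hIA : I ⊆ A := fun i hi => by
    rw [hI, Finset.mem_Ico] at hi
    exact h.mem i hi.1 hi.2
  have hsep : Separated I (A \ I) := by
    intro a ha b hb
    simp only [hI, Finset.mem_sdiff, Finset.mem_Ico] at ha hb
    have h1 : b + 1 ≠ s := fun hb' => h.left b hb' hb.1
    have h2 : b ≠ s + m := fun hb' => h.right (hb' ▸ hb.1)
    omega
  have hA : A = I ∪ (A \ I) := (Finset.union_sdiff_of_subset hIA).symm
  have hA' : removeNear A v = removeNear I v ∪ (A \ I) := by
    ext k
    simp only [removeNear, Finset.mem_filter, Finset.mem_union, Finset.mem_sdiff]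
    constructor
    · rintro ⟨h1, h2⟩
      by_cases hk : k ∈ I
      · exact Or.inl ⟨hk, h2⟩
      · exact Or.inr ⟨h1, hk⟩
    · rintro (⟨h1, h2⟩ | ⟨h1, h2⟩)
      · exact ⟨hIA h1, h2⟩
      · refine ⟨h1, fun hk => ?_⟩
        have h3 : k + 1 ≠ s := fun hk' => h.left k hk' h1
        have h4 : k ≠ s + m := fun hk' => h.right (hk' ▸ h1)
        rw [hI, Finset.mem_Ico] at h2
        rcases Nat.lt_or_ge k s with h5 | h5
        · have h6 : v + 1 = s := by omega
          exact hgap (h.left v h6) k (by omega) h1 (h6 ▸ h.mem s le_rfl (by omega))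
        · have h6 : v = s + m := by omega
          have h7 : k = v + 1 := by omega
          exact hgap (h6 ▸ h.right) (v - 1) (by omega)
            (h.mem _ (by omega) (by omega)) (h7 ▸ h1)
  have hsep' : Separated (removeNear I v) (A \ I) := fun a ha =>
    hsep a (Finset.mem_filter.1 ha).1
  have e1 : runPotential A = runWeight m + runPotential (A \ I) := by
    conv_lhs => rw [hA, runPotential_union hsep, hI, runPotential_Ico]
    simp [hI]
  rw [hA', runPotential_union hsep', e1, hI, runPotential_removeNear_Ico,
    show min (s + m) (v - 1) - s = v + 1 - s - 2 by omega,
    show s + m - max s (v + 2) = m - (v + 1 - s) - 1 by omega]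
  ring

theorem exists_isRun_not_dvd {A : Finset ℕ} {d : ℕ} (h : ¬ d ∣ runPotential A) :
    ∃ s m, IsRun A s m ∧ ¬ d ∣ runWeight m := by
  by_contra! hall
  refine h (Finset.dvd_sum fun k hk => ?_)
  obtain ⟨hk, hk'⟩ := Finset.mem_filter.1 hk
  obtain ⟨s, hs, -⟩ := isRun_runLength hk hk'
  exact hall _ _ hs

/-- If some maximal run has length at least two, then there is one from which Staller can remove
one vertex, and Dominator four, with an optimal change of the potential. -/
theorem exists_isRun_balanced {A : Finset ℕ} (h : ∃ s m, IsRun A s m ∧ 2 ≤ m) :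
    ∃ s m, IsRun A s m ∧ 2 ≤ m ∧
      (runPotential A + 7) / 8 ≤ (runPotential A + runWeight (m - 1) + 8 - runWeight m) / 8 ∧
      (runPotential A + runWeight (m - 4) + 15 - runWeight m) / 8 ≤ runPotential A / 8 := by
  have key : ∃ s m, IsRun A s m ∧ 2 ≤ m ∧
      ((runPotential A % 2 = 1 ∧ runWeight m % 2 ≠ 0) ∨
      (runPotential A % 4 = 2 ∧ runWeight m % 4 ≠ 0) ∨
      (runPotential A % 8 = 4 ∧ runWeight m % 8 ≠ 0) ∨ runPotential A % 8 = 0) := by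
    have aux : ∀ d, ¬ d ∣ runPotential A → ∃ s m, IsRun A s m ∧ 2 ≤ m ∧ runWeight m % d ≠ 0 := by
      intro d hd
      obtain ⟨s, m, hs, hm⟩ := exists_isRun_not_dvd hd
      refine ⟨s, m, hs, two_le_of_runWeight_ne_zero fun h0 => hm (h0 ▸ dvd_zero d), fun h0 => ?_⟩
      exact hm (Nat.dvd_of_mod_eq_zero h0)
    by_cases h2 : 2 ∣ runPotential A
    · by_cases h4 : 4 ∣ runPotential A
      · by_cases h8 : 8 ∣ runPotential A
        · obtain ⟨s, m, hs, hm⟩ := h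
          exact ⟨s, m, hs, hm, by omega⟩
        · obtain ⟨s, m, hs, hm, hw⟩ := aux 8 h8
          exact ⟨s, m, hs, hm, by omega⟩
      · obtain ⟨s, m, hs, hm, hw⟩ := aux 4 h4
        exact ⟨s, m, hs, hm, by omega⟩
    · obtain ⟨s, m, hs, hm, hw⟩ := aux 2 h2
      exact ⟨s, m, hs, hm, by omega⟩
  obtain ⟨s, m, hs, hm, hcase⟩ := key
  refine ⟨s, m, hs, hm, ?_⟩
  have hw := runWeight_balanced hm
  rcases hcase with hcase | hcase | hcase | hcase
  · have := hw.1 hcase.2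
    omega
  · have := hw.2.1 hcase.2
    omega
  · have := hw.2.2.1 hcase.2
    omega
  · have := hw.2.2.2
    omega

open Classical in
/-- The undominated vertices of the path on `n` vertices, as a set of natural numbers. -/
noncomputable def undominated {n : ℕ} (X : Set (Fin n)) : Finset ℕ :=
  (Finset.range n).filter fun k => ∀ x ∈ X, ¬(x.val ≤ k + 1 ∧ k ≤ x.val + 1)

theorem mem_undominated_iff {n : ℕ} {X : Set (Fin n)} {k : ℕ} :
    k ∈ undominated X ↔ k < n ∧ ∀ x ∈ X, ¬(x.val ≤ k + 1 ∧ k ≤ x.val + 1) := by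
  simp [undominated]

theorem val_mem_undominated_iff {n : ℕ} {X : Set (Fin n)} {u : Fin n} :
    u.val ∈ undominated X ↔ u ∉ closedNbhdSet (pathGraph n) X := by
  simp only [undominated, closedNbhdSet, Finset.mem_filter, Finset.mem_range, u.isLt, true_and,
    Set.mem_ofPred_eq, pathGraph_adj, not_or, not_exists, not_and]
  constructor
  · intro h
    refine ⟨fun hu => by have := h u hu; omega, fun x hx => ?_⟩
    have := h x hx
    omega
  · rintro ⟨h1, h2⟩ x hx hxu
    have h3 : x ≠ u := fun hxu => h1 (hxu ▸ hx)
    have h4 := h2 x hx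
    have h5 : x.val ≠ u.val := fun h => h3 (Fin.ext h)
    omega

theorem isPlayable_pathGraph_iff {n : ℕ} {X : Set (Fin n)} {v : Fin n} :
    IsPlayable (pathGraph n) X v ↔ ∃ u ∈ undominated X, (v.val ≤ u + 1 ∧ u ≤ v.val + 1) ∧
      ∃ w ∈ undominated X, u + 1 = w ∨ w + 1 = u := by
  constructor
  · rintro ⟨u, huv, hu, w, huw, hw⟩
    refine ⟨u, val_mem_undominated_iff.2 hu, ?_, w, val_mem_undominated_iff.2 hw,
      pathGraph_adj.1 huw⟩
    rcases huv with rfl | huv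
    · omega
    · rw [pathGraph_adj] at huv
      omega
  · rintro ⟨u, hu, huv, w, hw, huw⟩
    have hun : u < n := (mem_undominated_iff.1 hu).1
    have hwn : w < n := (mem_undominated_iff.1 hw).1
    refine ⟨⟨u, hun⟩, ?_, val_mem_undominated_iff.1 hu, ⟨w, hwn⟩, pathGraph_adj.2 huw,
      val_mem_undominated_iff.1 hw⟩
    rw [pathGraph_adj, Fin.ext_iff]
    dsimp only
    omega

theorem undominated_insert {n : ℕ} (X : Set (Fin n)) (v : Fin n) :
    undominated (insert v X) = removeNear (undominated X) v := by
  ext k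
  simp only [undominated, removeNear, Finset.mem_filter, Set.forall_mem_insert]
  tauto

theorem undominated_empty (n : ℕ) : undominated (∅ : Set (Fin n)) = Finset.Ico 0 n := by
  ext k
  simp [undominated]

theorem undominated_gap {n : ℕ} {X : Set (Fin n)} {v : ℕ} (hvn : v < n)
    (hv : v ∉ undominated X) (i : ℕ) (hi : i + 1 = v) (hiX : i ∈ undominated X) :
    v + 1 ∉ undominated X := by
  intro h
  rw [mem_undominated_iff] at *
  push Not at hv
  obtain ⟨x, hx, h1⟩ := hv hvn
  have h2 := hiX.2 x hx
  have h3 := h.2 x hx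
  omega

theorem card_undominated_insert_lt {n : ℕ} {X : Set (Fin n)} {v : Fin n}
    (h : IsPlayable (pathGraph n) X v) :
    (undominated (insert v X)).card < (undominated X).card := by
  obtain ⟨u, hu, huv, -⟩ := isPlayable_pathGraph_iff.1 h
  rw [undominated_insert]
  refine Finset.card_lt_card (Finset.filter_ssubset.2 ⟨u, hu, ?_⟩)
  simpa using huv

theorem exists_isRun_of_isPlayable {n : ℕ} {X : Set (Fin n)} {v : Fin n}
    (h : IsPlayable (pathGraph n) X v) :
    ∃ s m, IsRun (undominated X) s m ∧ 2 ≤ m ∧ s ≤ v.val + 1 ∧ v.val ≤ s + m := by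
  obtain ⟨u, hu, huv, w, hw, huw⟩ := isPlayable_pathGraph_iff.1 h
  obtain ⟨s, m, hs, h1, h2⟩ := exists_isRun hu
  refine ⟨s, m, hs, ?_, by omega, by omega⟩
  have h3 : w + 1 ≠ s := fun hw' => hs.left w hw' hw
  have h4 : w ≠ s + m := fun hw' => hs.right (hw' ▸ hw)
  omega

theorem IsRun.isPlayable {n : ℕ} {X : Set (Fin n)} {s m : ℕ} (h : IsRun (undominated X) s m)
    (hm : 2 ≤ m) {v : Fin n} (hv : s ≤ v.val + 1) (hv' : v.val ≤ s + m) :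
    IsPlayable (pathGraph n) X v := by
  rw [isPlayable_pathGraph_iff]
  by_cases hvs : v.val + 1 < s + m
  · exact ⟨max s v, h.mem _ (by omega) (by omega), by omega, max s v + 1,
      h.mem _ (by omega) (by omega), Or.inl rfl⟩
  · exact ⟨s + m - 1, h.mem _ (by omega) (by omega), by omega, s + m - 2,
      h.mem _ (by omega) (by omega), by omega⟩

theorem runPotential_undominated_insert {n : ℕ} {X : Set (Fin n)} {s m : ℕ}
    (h : IsRun (undominated X) s m) (hm : 2 ≤ m) {v : Fin n}
    (hv : s ≤ v.val + 1) (hv' : v.val ≤ s + m) :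
    runPotential (undominated (insert v X)) + runWeight m =
      runPotential (undominated X) + runWeight (v + 1 - s - 2) +
        runWeight (m - (v + 1 - s) - 1) := by
  rw [undominated_insert]
  exact h.runPotential_removeNear (undominated_gap v.isLt) hm hv hv'

theorem runPotential_insert_bounds {n : ℕ} {X : Set (Fin n)} {v : Fin n}
    (h : IsPlayable (pathGraph n) X v) :
    runPotential (undominated (insert v X)) + 1 ≤ runPotential (undominated X) ∧
      runPotential (undominated X) ≤ runPotential (undominated (insert v X)) + 15 := by
  obtain ⟨s, m, hs, hm, h1, h2⟩ := exists_isRun_of_isPlayable h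
  have h3 := runPotential_undominated_insert hs hm h1 h2
  have h4 := runWeight_move (m := m) (p := v + 1 - s) hm (by omega)
  omega

theorem exists_optimal_dominator_move {n : ℕ} {X : Set (Fin n)}
    (h : ∃ v, IsPlayable (pathGraph n) X v) :
    ∃ v, IsPlayable (pathGraph n) X v ∧
      (runPotential (undominated (insert v X)) + 7) / 8 + 1 ≤
        runPotential (undominated X) / 8 := by
  obtain ⟨v₀, hv₀⟩ := h
  obtain ⟨s₀, m₀, hs₀, hm₀, -⟩ := exists_isRun_of_isPlayable hv₀
  obtain ⟨s, m, hs, hm, -, hbound⟩ := exists_isRun_balanced ⟨s₀, m₀, hs₀, hm₀⟩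
  have hmem : s + min 2 (m - 1) ∈ undominated X := hs.mem _ (by omega) (by omega)
  have hlt : s + min 2 (m - 1) < n := (mem_undominated_iff.1 hmem).1
  refine ⟨⟨_, hlt⟩, hs.isPlayable hm (by dsimp only; omega) (by dsimp only; omega), ?_⟩
  have h3 := runPotential_undominated_insert hs hm (v := ⟨_, hlt⟩)
    (by dsimp only; omega) (by dsimp only; omega)
  have h0 : runWeight (s + min 2 (m - 1) + 1 - s - 2) = 0 := by
    have : s + min 2 (m - 1) + 1 - s - 2 ≤ 1 := by omega
    generalize s + min 2 (m - 1) + 1 - s - 2 = a at this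
    interval_cases a <;> rfl
  dsimp only at h3
  rw [h0, show m - (s + min 2 (m - 1) + 1 - s) - 1 = m - 4 by omega] at h3
  omega

theorem exists_optimal_staller_move {n : ℕ} {X : Set (Fin n)} (hX : X.Nonempty)
    (h : ∃ v, IsPlayable (pathGraph n) X v) :
    ∃ v, IsPlayable (pathGraph n) X v ∧
      (runPotential (undominated X) + 7) / 8 ≤
        runPotential (undominated (insert v X)) / 8 + 1 := by
  obtain ⟨v₀, hv₀⟩ := h
  obtain ⟨s₀, m₀, hs₀, hm₀, -⟩ := exists_isRun_of_isPlayable hv₀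
  obtain ⟨s, m, hs, hm, hbound, -⟩ := exists_isRun_balanced ⟨s₀, m₀, hs₀, hm₀⟩
  have hend : s + m - 1 < n :=
    (mem_undominated_iff.1 (hs.mem (s + m - 1) (by omega) (by omega))).1
  have h0 : runWeight 0 = 0 := rfl
  rcases Nat.eq_zero_or_pos s with rfl | hpos
  · have hlt : m < n := by
      obtain ⟨x, hx⟩ := hX
      have hx' : x.val ∉ undominated X := fun hmem =>
        (mem_undominated_iff.1 hmem).2 x hx (by omega)
      by_contra! hle
      exact hx' (hs.mem _ (by omega) (by omega))
    refine ⟨⟨m, hlt⟩, hs.isPlayable hm (by dsimp only; omega) (by dsimp only; omega), ?_⟩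
    have h3 := runPotential_undominated_insert hs hm (v := ⟨m, hlt⟩)
      (by dsimp only; omega) (by dsimp only; omega)
    dsimp only at h3
    rw [show m + 1 - 0 - 2 = m - 1 by omega, show m - (m + 1 - 0) - 1 = 0 by omega, h0] at h3
    omega
  · refine ⟨⟨s - 1, by omega⟩, hs.isPlayable hm (by dsimp only; omega) (by dsimp only; omega), ?_⟩
    have h3 := runPotential_undominated_insert hs hm (v := ⟨s - 1, by omega⟩)
      (by dsimp only; omega) (by dsimp only; omega)
    dsimp only at h3
    rw [show s - 1 + 1 - s - 2 = 0 by omega, show m - (s - 1 + 1 - s) - 1 = m - 1 by omega,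
      h0] at h3
    omega

theorem runPotential_eq_zero_of_not_playable {n : ℕ} {X : Set (Fin n)}
    (h : ¬ ∃ v, IsPlayable (pathGraph n) X v) : runPotential (undominated X) = 0 := by
  by_contra h0
  obtain ⟨s, m, hs, hm⟩ := exists_isRun_not_dvd (d := 0) (by simpa using h0)
  have hm2 := two_le_of_runWeight_ne_zero (by simpa using hm)
  have hlt : s < n :=
    (mem_undominated_iff.1 (hs.mem s le_rfl (by omega))).1
  exact h ⟨⟨s, hlt⟩, hs.isPlayable hm2 (by dsimp only; omega) (by dsimp only; omega)⟩

/-- Once some vertex has been selected, the value of a position is its potential in moves,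
rounded down if Dominator is to move and rounded up if Staller is to move. -/
theorem isoGameVal_pathGraph {n : ℕ} (k : ℕ) (isDom : Bool) {X : Set (Fin n)} (hX : X.Nonempty)
    (hk : (undominated X).card ≤ k) :
    isoGameVal (pathGraph n) k isDom X =
      if isDom then runPotential (undominated X) / 8
      else (runPotential (undominated X) + 7) / 8 := by
  induction k generalizing isDom X with
  | zero =>
    have h0 : undominated X = ∅ := Finset.card_eq_zero.1 (by omega)
    have h1 : runPotential ∅ = 0 := rfl
    simp [isoGameVal, h0, h1]
  | succ k ih =>
    have hval : ∀ b v, IsPlayable (pathGraph n) X v →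
        isoGameVal (pathGraph n) k b (insert v X) =
          if b then runPotential (undominated (insert v X)) / 8
          else (runPotential (undominated (insert v X)) + 7) / 8 := fun b v hv =>
      ih b (Set.insert_nonempty v X) (by have := card_undominated_insert_lt hv; omega)
    rw [isoGameVal]
    split_ifs with hp hd hd
    · subst hd
      refine IsLeast.csInf_eq ⟨?_, ?_⟩
      · obtain ⟨v, hv, hle⟩ := exists_optimal_dominator_move hp
        refine ⟨v, hv, ?_⟩
        rw [hval _ v hv]
        have := runPotential_insert_bounds hv
        simp only [Bool.not_true, Bool.false_eq_true, if_false]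
        omega
      · rintro _ ⟨v, hv, rfl⟩
        rw [hval _ v hv]
        have := runPotential_insert_bounds hv
        simp only [Bool.not_true, Bool.false_eq_true, if_false]
        omega
    · obtain rfl : isDom = false := by simpa using hd
      refine IsGreatest.csSup_eq ⟨?_, ?_⟩
      · obtain ⟨v, hv, hle⟩ := exists_optimal_staller_move hX hp
        refine ⟨v, hv, ?_⟩
        rw [hval _ v hv]
        have := runPotential_insert_bounds hv
        simp only [Bool.not_false, if_true]
        omega
      · rintro _ ⟨v, hv, rfl⟩
        rw [hval _ v hv]
        have := runPotential_insert_bounds hv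
        simp only [Bool.not_false, if_true]
        omega
    · rw [runPotential_eq_zero_of_not_playable hp]
    · rw [runPotential_eq_zero_of_not_playable hp]

theorem first_move_le {n v : ℕ} (hn : 2 ≤ n) (hv : v < n) :
    (runWeight (v - 1) + runWeight (n - (v + 2))) / 8 + 1 ≤ (2 * n + 2) / 5 := by
  obtain ⟨q, hq⟩ := runWeight_cases (v - 1)
  obtain ⟨r, hr⟩ := runWeight_cases (n - (v + 2))
  rcases hq with hq | hq | hq | hq | hq | hq <;> rcases hr with hr | hr | hr | hr | hr | hr <;>
    omega

theorem exists_first_move {n : ℕ} (hn : 2 ≤ n) :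
    ∃ v < n, (2 * n + 2) / 5 ≤ (runWeight (v - 1) + runWeight (n - (v + 2))) / 8 + 1 := by
  by_cases h : n % 5 = 2 ∧ 7 ≤ n
  · have h2 : runWeight (3 - 1) = 8 := rfl
    obtain ⟨q, hq⟩ := runWeight_cases (n - (3 + 2))
    exact ⟨3, by omega, by omega⟩
  · have h0 : runWeight (0 - 1) = 0 := rfl
    obtain ⟨q, hq⟩ := runWeight_cases (n - (0 + 2))
    exact ⟨0, by omega, by omega⟩

/-- Theorem 1.5 (S-game part): for every `n ≥ 1`, `ι_g'(P_n) = ⌊(2n+2)/5⌋`. -/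
theorem stallerStart_game_isolation_number_path (n : ℕ) (hn : 1 ≤ n) :
    iotaGame' (SimpleGraph.pathGraph n) = (2 * n + 2) / 5 := by
  unfold iotaGame'
  rw [Fintype.card_fin]
  obtain ⟨k, rfl⟩ : ∃ k, n = k + 1 := ⟨n - 1, by omega⟩
  rw [isoGameVal]
  rcases Nat.lt_or_ge k 1 with hk | hk
  · obtain rfl : k = 0 := by omega
    rw [if_neg]
    rintro ⟨v, u, -, -, w, huw, -⟩
    rw [pathGraph_adj] at huw
    omega
  have hrun : IsRun (undominated (∅ : Set (Fin (k + 1)))) 0 (k + 1) := by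
    rw [undominated_empty]
    exact ⟨fun i _ _ => by simp; omega, fun i hi => by omega, by simp⟩
  have hplay : ∀ v, IsPlayable (pathGraph (k + 1)) ∅ v := fun v =>
    hrun.isPlayable (by omega) (by omega) (by omega)
  have hval : ∀ v : Fin (k + 1), isoGameVal (pathGraph (k + 1)) k true (insert v ∅) =
      (runWeight (v - 1) + runWeight (k + 1 - (v + 2))) / 8 := by
    intro v
    have hcard := card_undominated_insert_lt (hplay v)
    have hcard' : (undominated (∅ : Set (Fin (k + 1)))).card = k + 1 := by
      simp [undominated_empty]
    rw [isoGameVal_pathGraph k true (Set.insert_nonempty v ∅) (by omega), if_pos rfl,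
      undominated_insert, undominated_empty, runPotential_removeNear_Ico,
      show min (k + 1) (v.val - 1) - 0 = v.val - 1 by omega,
      show max 0 (v.val + 2) = v.val + 2 by omega]
  rw [if_pos ⟨0, hplay 0⟩, if_neg (by simp)]
  refine IsGreatest.csSup_eq ⟨?_, ?_⟩
  · obtain ⟨v, hv, hle⟩ := exists_first_move (n := k + 1) (by omega)
    refine ⟨⟨v, hv⟩, hplay _, ?_⟩
    rw [Bool.not_false, hval]
    exact le_antisymm hle (first_move_le (by omega) hv)
  · rintro _ ⟨v, hv, rfl⟩
    rw [Bool.not_false, hval]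
    exact first_move_le (by omega) v.isLt
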